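/- Let N ≥ 1, 0 < α < N, max{-(N+α), -4(1+α/N)} < 2b < 0 and 1 + α/N < p < p^*, where p^* := 1 + (4+2b+α)/(N-4) if N ≥ 5 and p^* := ∞ if 1 ≤ N ≤ 4. Then there exists a constant C = C(N, p, b, α) > 0 such that for every Schwartz function u on ℝ^N, ∫_{ℝ^N} (I_α * |·|^b|u|^p)(x) |x|^b |u(x)|^p dx ≤ C ‖u‖₂^{A} ‖Δu‖₂^{B}, where B := (Np - N - α - 2b)/2 and A := 2p - B. -/

import Mathlib

open MeasureTheory Filter Complex SchwartzMap
open scoped FourierTransform ENNReal NNReal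

noncomputable section

/-- `N`-dimensional Euclidean space. -/
abbrev EV (N : ℕ) := EuclideanSpace ℝ (Fin N)

/-- Partial derivative in the `j`-th coordinate direction. -/
def pd {N : ℕ} {F : Type*} [NormedAddCommGroup F] [NormedSpace ℝ F]
    (j : Fin N) (f : EV N → F) : EV N → F :=
  fun x => fderiv ℝ f x (EuclideanSpace.single j 1)

/-- The Laplacian, as the sum of the second partial derivatives. -/
def lap {N : ℕ} {F : Type*} [NormedAddCommGroup F] [NormedSpace ℝ F]
    (f : EV N → F) : EV N → F :=
  fun x => ∑ j : Fin N, pd j (pd j f) x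

/-- The mass `∫ |f|²`. -/
def massI {N : ℕ} (f : EV N → ℂ) : ℝ := ∫ x : EV N, ‖f x‖ ^ 2

/-- The `L²` norm. -/
def L2 {N : ℕ} (f : EV N → ℂ) : ℝ := (massI f) ^ ((1 : ℝ)/2)

/-- The `H²` norm `(‖f‖₂² + ‖Δf‖₂²)^(1/2)`. -/
def H2n {N : ℕ} (f : EV N → ℂ) : ℝ := ((L2 f) ^ 2 + (L2 (lap f)) ^ 2) ^ ((1 : ℝ)/2)

/-- The Riesz potential kernel `I_α`. -/
def riesz (N : ℕ) (α : ℝ) (x : EV N) : ℝ :=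
  Real.Gamma (((N : ℝ) - α)/2) /
    (Real.Gamma (α/2) * Real.pi ^ ((N : ℝ)/2) * 2 ^ α * ‖x‖ ^ ((N : ℝ) - α))

/-- The convolution `(I_α * |·|^b |f|^p)(x)`. -/
def rzConv {N : ℕ} (α b p : ℝ) (f : EV N → ℂ) (x : EV N) : ℝ :=
  ∫ y : EV N, riesz N α (x - y) * (‖y‖ ^ b * ‖f y‖ ^ p)

/-- The Choquard potential `∫ (I_α * |·|^b|f|^p)(x) |x|^b |f(x)|^p dx`. -/
def potC {N : ℕ} (α b p : ℝ) (f : EV N → ℂ) : ℝ :=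
  ∫ x : EV N, rzConv α b p f x * ‖x‖ ^ b * ‖f x‖ ^ p

/-- The energy for the Choquard problem. -/
def energyC {N : ℕ} (α b p : ℝ) (f : EV N → ℂ) : ℝ :=
  (L2 (lap f)) ^ 2 - (1/p) * potC α b p f

/-- `B := (Np - N - α - 2b)/2`. -/
def Bc (N : ℕ) (α b p : ℝ) : ℝ := ((N : ℝ)*p - N - α - 2*b)/2

/-- `A := 2p - B`. -/
def Ac (N : ℕ) (α b p : ℝ) : ℝ := 2*p - Bc N α b p

/-- The critical Sobolev index `s'_c := N/2 - (4+2b+α)/(2(p-1))`. -/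
def scC (N : ℕ) (α b p : ℝ) : ℝ := (N : ℝ)/2 - (4 + 2*b + α)/(2*(p - 1))

/-- Condition (𝒞) on the parameters `(N, α, b)`. -/
def CondC (N : ℕ) (α b : ℝ) : Prop :=
  0 < α ∧ α < N ∧
  max (max (-((N : ℝ) + α)) (-4*(1 + α/(N : ℝ)))) ((N : ℝ) - 8 - α) < 2*b ∧ 2*b < 0 ∧
  (5 ≤ N ∨ (3 ≤ N ∧ N ≤ 4 ∧ 0 < 2*α + 4*b + (N : ℝ)))

/-- A ground state for the Choquard problem: a nonzero Schwartz solution of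
`φ + Δ²φ - (I_α * |·|^b|φ|^p)|x|^b|φ|^(p-2)φ = 0` satisfying the Pohozaev identities and
attaining the sharp Gagliardo-Nirenberg constant. -/
def IsGroundStateC (N : ℕ) (α b p : ℝ) (φ : SchwartzMap (EV N) ℂ) : Prop :=
  φ ≠ 0 ∧
  (∀ x : EV N, x ≠ 0 →
    φ x + lap (lap (⇑φ)) x
      - ((rzConv α b p ⇑φ x * ‖x‖ ^ b * ‖φ x‖ ^ (p - 2) : ℝ) : ℂ) * φ x = 0) ∧
  (L2 (lap ⇑φ)) ^ 2 = (Bc N α b p / (2*p)) * potC α b p ⇑φ ∧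
  (L2 ⇑φ) ^ 2 = (Ac N α b p / (2*p)) * potC α b p ⇑φ ∧
  (∀ v : SchwartzMap (EV N) ℂ,
    potC α b p ⇑v ≤ (2*p / Ac N α b p) * (Ac N α b p / Bc N α b p) ^ (Bc N α b p / 2)
      * (L2 ⇑φ) ^ (-(2*(p-1))) * (L2 ⇑v) ^ (Ac N α b p) * (L2 (lap ⇑v)) ^ (Bc N α b p))

/-- `ME'[v] := (E[v]/E[φ])^(s'_c) (M[v]/M[φ])^(2-s'_c)`. -/
def MEc {N : ℕ} (α b p : ℝ) (φ : SchwartzMap (EV N) ℂ) (v : EV N → ℂ) : ℝ :=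
  (energyC α b p v / energyC α b p ⇑φ) ^ (scC N α b p)
    * (massI v / massI ⇑φ) ^ (2 - scC N α b p)

/-- `MG'[v] := (‖Δv‖₂/‖Δφ‖₂)^(s'_c) (‖v‖₂/‖φ‖₂)^(2-s'_c)`. -/
def MGc {N : ℕ} (α b p : ℝ) (φ : SchwartzMap (EV N) ℂ) (v : EV N → ℂ) : ℝ :=
  (L2 (lap v) / L2 (lap ⇑φ)) ^ (scC N α b p) * (L2 v / L2 ⇑φ) ^ (2 - scC N α b p)

/-- The `L^r` norm for a real exponent `r`. -/
def Lnorm {N : ℕ} (r : ℝ) (f : EV N → ℂ) : ℝ := (∫ x : EV N, ‖f x‖ ^ r) ^ (1/r)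

section FourierSide

open scoped Laplacian

variable {N : ℕ}

lemma lap_coe_eq_laplacian (u : 𝓢(EV N, ℂ)) : lap ⇑u = ⇑(Δ u : 𝓢(EV N, ℂ)) := by
  funext x
  rw [SchwartzMap.laplacian_eq_sum (EuclideanSpace.basisFun (Fin N) ℝ) u]
  simp only [lap, _root_.sum_apply, EuclideanSpace.basisFun_apply]
  rfl

lemma massI_nonneg (f : EV N → ℂ) : 0 ≤ massI f := integral_nonneg fun _ => by positivity

lemma massI_fourier (u : 𝓢(EV N, ℂ)) : massI ⇑(𝓕 u : 𝓢(EV N, ℂ)) = massI ⇑u :=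
  SchwartzMap.integral_norm_sq_fourier u

lemma norm_fourier_laplacian_apply (u : 𝓢(EV N, ℂ)) (ξ : EV N) :
    ‖𝓕 (Δ u) ξ‖ = (2 * Real.pi) ^ 2 * ‖ξ‖ ^ 2 * ‖𝓕 u ξ‖ := by
  rw [SchwartzMap.laplacian_eq_fourierMultiplierCLM, SchwartzMap.fourierMultiplierCLM_apply,
    FourierTransform.fourier_smul, FourierTransform.fourier_fourierInv_eq,
    _root_.smul_apply, SchwartzMap.smulLeftCLM_apply_apply (by fun_prop), norm_smul,
    norm_smul, norm_neg, Real.norm_of_nonneg (by positivity), Real.norm_of_nonneg (by positivity),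
    mul_assoc]

lemma integrable_norm_sq (u : 𝓢(EV N, ℂ)) : Integrable (fun x => ‖u x‖ ^ 2) := by
  have := (u.memLp 2 volume).integrable_norm_rpow (by simp) (by simp)
  simpa using this

lemma exists_freq_split {γ : ℝ} (hγ : 0 < γ) (hN : (N : ℝ) < 4 + 2 * γ) :
    ∃ K > 0, ∀ u : 𝓢(EV N, ℂ), massI ⇑u ≤ 1 → massI (lap ⇑u) ≤ 1 → ∀ R : ℝ, 1 ≤ R →
      ∃ v : 𝓢(EV N, ℂ), (∀ x, ‖v x‖ ≤ K * R ^ γ) ∧ R ^ 4 * massI ⇑(u - v) ≤ 1 := by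
  set w : EV N → ℝ := fun ξ => (1 + ‖ξ‖ ^ 2) ^ (-(4 + 2 * γ) / 2) with hw
  have hwi : Integrable w := integrable_rpow_neg_one_add_norm_sq (by simpa using hN)
  have hw0 : ∀ ξ, 0 ≤ w ξ := fun ξ => by positivity
  have hW : 0 ≤ ∫ ξ, w ξ := integral_nonneg hw0
  refine ⟨5 ^ (γ / 2) * ((∫ ξ, w ξ) + 4), by positivity, fun u hu hlu R hR => ?_⟩
  have hR0 : 0 < R := by linarith
  let χ : ContDiffBump (0 : EV N) := ⟨R, 2 * R, hR0, by linarith⟩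
  have hχ : Function.HasTemperateGrowth (χ : EV N → ℝ) :=
    χ.hasCompactSupport.hasTemperateGrowth χ.contDiff
  set g : 𝓢(EV N, ℂ) := SchwartzMap.smulLeftCLM ℂ (χ : EV N → ℝ) (𝓕 u) with hg
  have hgx : ∀ ξ, g ξ = χ ξ • 𝓕 u ξ := fun ξ => SchwartzMap.smulLeftCLM_apply_apply hχ _ _
  rw [lap_coe_eq_laplacian] at hlu
  have hΔ : ∀ ξ, ‖ξ‖ ^ 2 * ‖𝓕 u ξ‖ ≤ ‖𝓕 (Δ u) ξ‖ := fun ξ => by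
    rw [norm_fourier_laplacian_apply, mul_assoc]
    refine le_mul_of_one_le_left (by positivity) ?_
    nlinarith [Real.pi_gt_three]
  have hi1 := integrable_norm_sq (𝓕 u)
  have hi2 := integrable_norm_sq (𝓕 (Δ u))
  have h1 : ∫ ξ, ‖𝓕 u ξ‖ ^ 2 ≤ 1 := (massI_fourier u).trans_le hu
  have h2 : ∫ ξ, ‖𝓕 (Δ u) ξ‖ ^ 2 ≤ 1 := (massI_fourier (Δ u)).trans_le hlu
  refine ⟨𝓕⁻ g, fun x => ?_, ?_⟩
  · have hb : ∀ ξ, ‖g ξ‖ ≤ 5 ^ (γ / 2) * R ^ γ *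
        (w ξ + (2 * ‖𝓕 u ξ‖ ^ 2 + 2 * ‖𝓕 (Δ u) ξ‖ ^ 2)) := fun ξ => by
      rw [hgx, norm_smul, Real.norm_of_nonneg χ.nonneg]
      by_cases hξ : ‖ξ‖ < 2 * R
      · have e0 : (0 : ℝ) < 1 + ‖ξ‖ ^ 2 := by positivity
        have e1 : (1 + ‖ξ‖ ^ 2) ^ (γ / 2) ≤ 5 ^ (γ / 2) * R ^ γ := by
          have : (5 : ℝ) ^ (γ / 2) * R ^ γ = (5 * R ^ 2) ^ (γ / 2) := by
            rw [Real.mul_rpow (by norm_num) (by positivity), ← Real.rpow_natCast R 2,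
              ← Real.rpow_mul hR0.le]
            congr 2
            push_cast
            ring
          rw [this]
          refine Real.rpow_le_rpow e0.le ?_ (by positivity)
          nlinarith [norm_nonneg ξ]
        have e2 : ‖𝓕 u ξ‖ = (1 + ‖ξ‖ ^ 2) ^ (γ / 2) *
            ((1 + ‖ξ‖ ^ 2) ^ (-(4 + 2 * γ) / 4) * ((1 + ‖ξ‖ ^ 2) * ‖𝓕 u ξ‖)) := by
          have : (1 + ‖ξ‖ ^ 2) ^ (γ / 2) * (1 + ‖ξ‖ ^ 2) ^ (-(4 + 2 * γ) / 4) * (1 + ‖ξ‖ ^ 2) = 1 := by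
            rw [← Real.rpow_add e0, ← Real.rpow_add_one e0.ne',
              show γ / 2 + -(4 + 2 * γ) / 4 + 1 = 0 by ring, Real.rpow_zero]
          linear_combination (-‖𝓕 u ξ‖) * this
        have e3 : w ξ = ((1 + ‖ξ‖ ^ 2) ^ (-(4 + 2 * γ) / 4)) ^ 2 := by
          simp only [hw]
          rw [← Real.rpow_natCast ((1 + ‖ξ‖ ^ 2) ^ (-(4 + 2 * γ) / 4)) 2, ← Real.rpow_mul e0.le]
          congr 1
          push_cast
          ring
        have e4 : (1 + ‖ξ‖ ^ 2) ^ (-(4 + 2 * γ) / 4) * ((1 + ‖ξ‖ ^ 2) * ‖𝓕 u ξ‖) ≤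
            w ξ + (2 * ‖𝓕 u ξ‖ ^ 2 + 2 * ‖𝓕 (Δ u) ξ‖ ^ 2) := by
          rw [e3]
          have := hΔ ξ
          set a := (1 + ‖ξ‖ ^ 2) ^ (-(4 + 2 * γ) / 4)
          have ha : 0 ≤ a := by positivity
          have q0 := norm_nonneg (𝓕 u ξ)
          have q1 : (1 + ‖ξ‖ ^ 2) * ‖𝓕 u ξ‖ ≤ ‖𝓕 u ξ‖ + ‖𝓕 (Δ u) ξ‖ := by linarith
          have q2 := mul_le_mul_of_nonneg_left q1 ha
          nlinarith [sq_nonneg (a - (‖𝓕 u ξ‖ + ‖𝓕 (Δ u) ξ‖)), sq_nonneg (‖𝓕 u ξ‖ - ‖𝓕 (Δ u) ξ‖)]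
        calc χ ξ * ‖𝓕 u ξ‖ ≤ ‖𝓕 u ξ‖ := mul_le_of_le_one_left (norm_nonneg _) χ.le_one
          _ ≤ _ := by
            rw [e2]
            have := e4.trans' (by positivity)
            gcongr
            rwa [← e2]
      · rw [χ.zero_of_le_dist (by simpa using hξ), zero_mul]
        have := hw0 ξ
        positivity
    calc ‖𝓕⁻ g x‖ ≤ ∫ ξ, ‖g ξ‖ := by
          rw [SchwartzMap.fourierInv_coe, Real.fourierInv_eq']
          refine (norm_integral_le_integral_norm _).trans_eq (integral_congr_ae (.of_forall fun ξ => ?_))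
          simp only [norm_smul]
          rw [Complex.norm_exp_ofReal_mul_I, one_mul]
      _ ≤ ∫ ξ, 5 ^ (γ / 2) * R ^ γ * (w ξ + (2 * ‖𝓕 u ξ‖ ^ 2 + 2 * ‖𝓕 (Δ u) ξ‖ ^ 2)) :=
          integral_mono g.integrable.norm
            ((hwi.add ((hi1.const_mul 2).add (hi2.const_mul 2))).const_mul _) hb
      _ = 5 ^ (γ / 2) * R ^ γ *
          ((∫ ξ, w ξ) + (2 * (∫ ξ, ‖𝓕 u ξ‖ ^ 2) + 2 * ∫ ξ, ‖𝓕 (Δ u) ξ‖ ^ 2)) := by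
          rw [integral_const_mul, integral_add (g := fun ξ => 2 * ‖𝓕 u ξ‖ ^ 2 + 2 * ‖𝓕 (Δ u) ξ‖ ^ 2)
            hwi ((hi1.const_mul 2).add (hi2.const_mul 2)),
            integral_add (hi1.const_mul 2) (hi2.const_mul 2), integral_const_mul,
            integral_const_mul]
      _ ≤ 5 ^ (γ / 2) * R ^ γ * ((∫ ξ, w ξ) + 4) := by gcongr; linarith
      _ = _ := by ring
  · rw [← massI_fourier, massI, ← integral_const_mul]
    refine (integral_mono ((integrable_norm_sq _).const_mul _) hi2 fun ξ => ?_).trans h2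
    have e : 𝓕 (u - 𝓕⁻ g) ξ = 𝓕 u ξ - χ ξ • 𝓕 u ξ := by
      rw [sub_eq_add_neg, FourierTransform.fourier_add, FourierTransform.fourier_neg,
        FourierTransform.fourier_fourierInv_eq, ← hgx]
      simp [sub_eq_add_neg]
    have hle : ‖𝓕 u ξ - χ ξ • 𝓕 u ξ‖ ≤ ‖𝓕 u ξ‖ := by
      have : 𝓕 u ξ - χ ξ • 𝓕 u ξ = (1 - χ ξ) • 𝓕 u ξ := by rw [sub_smul, one_smul]
      rw [this, norm_smul, Real.norm_of_nonneg (by linarith [χ.le_one (x := ξ)])]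
      exact mul_le_of_le_one_left (norm_nonneg _) (by linarith [χ.nonneg (x := ξ)])
    simp only [e]
    by_cases hξ : ‖ξ‖ ≤ R
    · rw [χ.one_of_mem_closedBall (by simpa using hξ)]
      simp
    · calc R ^ 4 * ‖𝓕 u ξ - χ ξ • 𝓕 u ξ‖ ^ 2 ≤ ‖ξ‖ ^ 4 * ‖𝓕 u ξ‖ ^ 2 := by gcongr; linarith
        _ = (‖ξ‖ ^ 2 * ‖𝓕 u ξ‖) ^ 2 := by ring
        _ ≤ _ := by gcongr; exact hΔ ξ

lemma volume_lt_norm_le (u : 𝓢(EV N, ℂ)) {t : ℝ} (ht : 0 < t) :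
    volume {x | t < ‖u x‖} ≤ ENNReal.ofReal (massI ⇑u / t ^ 2) := by
  have h := mul_meas_ge_le_integral_of_nonneg (μ := volume) (f := fun x => ‖u x‖ ^ 2)
    (.of_forall fun _ => by positivity) (integrable_norm_sq u) (t ^ 2)
  have hfin : volume {x | t ^ 2 ≤ ‖u x‖ ^ 2} ≠ ⊤ :=
    ((integrable_norm_sq u).measure_ge_lt_top (by positivity)).ne
  calc volume {x | t < ‖u x‖} ≤ volume {x | t ^ 2 ≤ ‖u x‖ ^ 2} :=
        measure_mono fun x (hx : t < _) => by
          simp only [Set.mem_ofPred_eq]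
          gcongr
    _ ≤ _ := by
        rw [← ENNReal.ofReal_toReal hfin]
        refine ENNReal.ofReal_le_ofReal ?_
        rw [le_div_iff₀' (by positivity)]
        exact h

lemma exists_volume_lt_norm_le {γ : ℝ} (hγ : 0 < γ) (hN : (N : ℝ) < 4 + 2 * γ) :
    ∃ K > 0, ∀ u : 𝓢(EV N, ℂ), massI ⇑u ≤ 1 → massI (lap ⇑u) ≤ 1 → ∀ t : ℝ, K ≤ t →
      volume {x | t < ‖u x‖} ≤ ENNReal.ofReal (4 * K ^ (4 / γ) * t ^ (-(2 + 4 / γ))) := by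
  obtain ⟨K, hK, h⟩ := exists_freq_split hγ hN
  refine ⟨2 * K, by positivity, fun u hu hlu t ht => ?_⟩
  have ht0 : 0 < t := by linarith
  have htK : 1 ≤ t / (2 * K) := (one_le_div (by positivity)).2 ht
  obtain ⟨v, hv, huv⟩ := h u hu hlu ((t / (2 * K)) ^ (1 / γ)) (Real.one_le_rpow htK (by positivity))
  have hRγ : ((t / (2 * K)) ^ (1 / γ)) ^ γ = t / (2 * K) := by
    rw [← Real.rpow_mul (by positivity), one_div_mul_cancel hγ.ne', Real.rpow_one]
  have hR4 : ((t / (2 * K)) ^ (1 / γ)) ^ 4 = (t / (2 * K)) ^ (4 / γ) := by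
    rw [← Real.rpow_natCast, ← Real.rpow_mul (by positivity)]
    congr 1
    push_cast
    ring
  rw [hRγ] at hv
  rw [hR4] at huv
  calc volume {x | t < ‖u x‖} ≤ volume {x | t / 2 < ‖(u - v) x‖} :=
        measure_mono fun x (hx : t < _) => by
          have h1 : ‖v x‖ ≤ t / 2 := (hv x).trans_eq (by field_simp)
          have h2 := norm_sub_norm_le (u x) (v x)
          simp only [Set.mem_ofPred_eq, _root_.sub_apply]
          linarith
    _ ≤ ENNReal.ofReal (massI ⇑(u - v) / (t / 2) ^ 2) := volume_lt_norm_le _ (by positivity)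
    _ ≤ _ := by
        refine ENNReal.ofReal_le_ofReal ?_
        have e : 4 * (2 * K) ^ (4 / γ) * t ^ (-(2 + 4 / γ)) =
            ((t / (2 * K)) ^ (4 / γ))⁻¹ / (t / 2) ^ 2 := by
          rw [Real.rpow_neg ht0.le, Real.rpow_add ht0, Real.div_rpow ht0.le (by positivity)]
          norm_cast
          field_simp
          norm_num
        rw [e]
        gcongr
        rw [← one_div, le_div_iff₀' (by positivity)]
        exact huv

/-- The non-endpoint Sobolev embedding `H² ⊂ L^s` for Schwartz functions. -/
lemma exists_lintegral_rpow_le {s : ℝ} (hs : 2 < s) (hsN : ((N : ℝ) - 4) * s < 2 * N) :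
    ∃ C : ℝ≥0, ∀ u : 𝓢(EV N, ℂ), massI ⇑u ≤ 1 → massI (lap ⇑u) ≤ 1 →
      ∫⁻ x, ENNReal.ofReal (‖u x‖ ^ s) ≤ C := by
  obtain ⟨γ, hγ1, hγ2⟩ : ∃ γ, max 0 (((N : ℝ) - 4) / 2) < γ ∧ γ < 4 / (s - 2) := by
    refine exists_between (max_lt (by apply div_pos <;> linarith) ?_)
    rw [lt_div_iff₀ (by linarith)]
    linarith
  have hγ : 0 < γ := (le_max_left _ _).trans_lt hγ1
  have hγN : (N : ℝ) < 4 + 2 * γ := by linarith [(le_max_right 0 (((N : ℝ) - 4) / 2)).trans_lt hγ1]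
  have hσ : s < 2 + 4 / γ := by
    rw [lt_div_iff₀ (by linarith)] at hγ2
    rw [← sub_lt_iff_lt_add', lt_div_iff₀ hγ]
    linarith
  obtain ⟨K, hK, hKu⟩ := exists_volume_lt_norm_le hγ hγN
  set σ := 2 + 4 / γ
  set A := 4 * K ^ (4 / γ)
  have hA : 0 < A := by positivity
  have hi1 : IntegrableOn (fun t : ℝ => t ^ (s - 3)) (Set.Ioc 0 K) :=
    (intervalIntegral.intervalIntegrable_rpow' (by linarith)).1
  have hi2 : IntegrableOn (fun t : ℝ => A * t ^ (s - 1 - σ)) (Set.Ioi K) :=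
    (integrableOn_Ioi_rpow_of_lt (by linarith) hK).const_mul _
  set I1 := ∫⁻ t in Set.Ioc 0 K, ENNReal.ofReal (t ^ (s - 3))
  set I2 := ∫⁻ t in Set.Ioi K, ENNReal.ofReal (A * t ^ (s - 1 - σ))
  have hI : ENNReal.ofReal s * (I1 + I2) ≠ ⊤ :=
    ENNReal.mul_ne_top ENNReal.ofReal_ne_top
      (ENNReal.add_ne_top.2 ⟨hi1.lintegral_lt_top.ne, hi2.lintegral_lt_top.ne⟩)
  refine ⟨(ENNReal.ofReal s * (I1 + I2)).toNNReal, fun u hu hlu => ?_⟩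
  rw [ENNReal.coe_toNNReal hI, lintegral_rpow_eq_lintegral_meas_lt_mul volume
    (Eventually.of_forall fun _ => norm_nonneg _) u.continuous.norm.aemeasurable (by linarith)]
  gcongr
  rw [← Set.Ioc_union_Ioi_eq_Ioi hK.le]
  refine (lintegral_union_le _ _ _).trans (add_le_add ?_ ?_)
  · refine setLIntegral_mono' measurableSet_Ioc fun t ht => ?_
    calc _ ≤ ENNReal.ofReal (1 / t ^ 2) * ENNReal.ofReal (t ^ (s - 1)) := by
          gcongr
          exact (volume_lt_norm_le u ht.1).trans (ENNReal.ofReal_le_ofReal (by gcongr))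
      _ = _ := by
          have := ht.1
          rw [← ENNReal.ofReal_mul (by positivity), show s - 3 = s - 1 - (2 : ℕ) by push_cast; ring,
            Real.rpow_sub_natCast this.ne']
          congr 1
          ring
  · refine setLIntegral_mono' measurableSet_Ioi fun t ht => ?_
    have ht' : K < t := ht
    have ht0 : 0 < t := hK.trans ht'
    calc _ ≤ ENNReal.ofReal (A * t ^ (-σ)) * ENNReal.ofReal (t ^ (s - 1)) := by
          gcongr
          exact hKu u hu hlu t ht'.le
      _ = _ := by
          rw [← ENNReal.ofReal_mul (by positivity), mul_assoc, ← Real.rpow_add ht0]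
          congr 3
          ring

end FourierSide

section Kernel

variable {N : ℕ}

lemma integrableOn_ball_norm_rpow_neg (hN : 1 ≤ N) {a : ℝ} (ha : a < N) :
    IntegrableOn (fun x : EV N => ‖x‖ ^ (-a)) (Metric.ball 0 1) :=
  integrableOn_ball_of_norm_le_rpow (C := 1) (by simpa using hN) (by simpa using ha)
    (.of_forall fun x => by rw [Real.norm_of_nonneg (by positivity), one_mul])
    (measurable_norm.pow_const _).aestronglyMeasurable

lemma integrableOn_compl_ball_norm_rpow_neg {a : ℝ} (ha : N < a) :
    IntegrableOn (fun x : EV N => ‖x‖ ^ (-a)) (Metric.ball 0 1)ᶜ := by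
  have ha0 : 0 < a := (Nat.cast_nonneg N).trans_lt ha
  have h : Integrable fun x : EV N => 2 ^ a * (1 + ‖x‖) ^ (-a) :=
    (integrable_one_add_norm (by simpa using ha)).const_mul _
  refine Integrable.mono' h.integrableOn (measurable_norm.pow_const _).aestronglyMeasurable ?_
  filter_upwards [ae_restrict_mem measurableSet_ball.compl] with x hx
  have hx1 : 1 ≤ ‖x‖ := by simpa using hx
  have hx0 : 0 < ‖x‖ := by linarith
  have e : 2 ^ a * (1 + ‖x‖) ^ (-a) = ((1 + ‖x‖) / 2) ^ (-a) := by
    rw [Real.div_rpow (by positivity) (by norm_num), Real.rpow_neg (by norm_num : (0 : ℝ) ≤ 2)]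
    field_simp
  rw [Real.norm_of_nonneg (by positivity), e]
  exact Real.rpow_le_rpow_of_nonpos (by positivity) (by linarith) (by linarith)

lemma exists_lintegral_weighted_rpow_le (hN : 1 ≤ N) {c q : ℝ} (hc : c < 0) (hcN : -(N : ℝ) < c)
    (hq : 2 < q) (hqN : ((N : ℝ) - 4) * q < 2 * (N + c)) :
    ∃ C : ℝ≥0, ∀ u : 𝓢(EV N, ℂ), massI ⇑u ≤ 1 → massI (lap ⇑u) ≤ 1 →
      ∫⁻ x, ENNReal.ofReal (‖x‖ ^ c * ‖u x‖ ^ q) ≤ C := by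
  have hN0 : (0 : ℝ) < N := by exact_mod_cast hN
  obtain ⟨τ, hτc, hτ⟩ : ∃ τ, -c / N < τ ∧ τ < min 1 (1 - ((N : ℝ) - 4) * q / (2 * N)) := by
    refine exists_between (lt_min ?_ ?_)
    · rw [div_lt_one hN0]
      linarith
    · have : ((N : ℝ) - 4) * q / (2 * N) < 2 * (N + c) / (2 * N) := by gcongr
      have e : 2 * (N + c) / (2 * N) = 1 - -c / N := by
        field_simp
        ring
      linarith
  obtain ⟨hτ1, hτ2⟩ := lt_min_iff.1 hτ
  have hτ0 : 0 < τ := (div_pos (neg_pos.2 hc) hN0).trans hτc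
  have hτ' : 0 < 1 - τ := by linarith
  have hsq : q ≤ q / (1 - τ) := le_div_self (by linarith) hτ' (by linarith)
  obtain ⟨C₁, hC₁⟩ := exists_lintegral_rpow_le (N := N) hq (by linarith)
  obtain ⟨C₂, hC₂⟩ := exists_lintegral_rpow_le (N := N) (s := q / (1 - τ)) (by linarith) (by
    have : ((N : ℝ) - 4) * q / (2 * N) < 1 - τ := by linarith
    rw [div_lt_iff₀ (by positivity)] at this
    rw [← mul_div_assoc, div_lt_iff₀ hτ']
    linarith)
  have hi : IntegrableOn (fun x : EV N => ‖x‖ ^ (c / τ)) (Metric.ball 0 1) := by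
    have : -c / τ < N := by
      rw [div_lt_iff₀ hτ0]
      rwa [div_lt_iff₀ hN0, mul_comm] at hτc
    simpa [neg_div] using integrableOn_ball_norm_rpow_neg hN this
  set I := ∫⁻ x in Metric.ball (0 : EV N) 1, ENNReal.ofReal (‖x‖ ^ (c / τ))
  have hI : I ≠ ⊤ := hi.lintegral_lt_top.ne
  refine ⟨I.toNNReal + C₂ + C₁, fun u hu hlu => ?_⟩
  have hm (s : ℝ) : Measurable fun x => ENNReal.ofReal (‖u x‖ ^ s) :=
    (u.continuous.norm.measurable.pow_const _).ennreal_ofReal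
  calc ∫⁻ x, ENNReal.ofReal (‖x‖ ^ c * ‖u x‖ ^ q)
      ≤ ∫⁻ x, ((Metric.ball (0 : EV N) 1).indicator (fun x => ENNReal.ofReal (‖x‖ ^ (c / τ))) x
        + ENNReal.ofReal (‖u x‖ ^ (q / (1 - τ))) + ENNReal.ofReal (‖u x‖ ^ q)) := by
        refine lintegral_mono fun x => ?_
        by_cases hx : x ∈ Metric.ball (0 : EV N) 1
        · rw [Set.indicator_of_mem hx, ← ENNReal.ofReal_add (by positivity) (by positivity)]
          refine le_add_right (ENNReal.ofReal_le_ofReal ?_)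
          have h := Real.geom_mean_le_arith_mean2_weighted hτ0.le hτ'.le
            (p₁ := ‖x‖ ^ (c / τ)) (p₂ := ‖u x‖ ^ (q / (1 - τ))) (by positivity) (by positivity)
            (by ring)
          rw [← Real.rpow_mul (by positivity), ← Real.rpow_mul (by positivity),
            div_mul_cancel₀ _ hτ0.ne', div_mul_cancel₀ _ hτ'.ne'] at h
          refine h.trans (add_le_add ?_ ?_) <;>
          exact mul_le_of_le_one_left (by positivity) (by linarith)
        · refine le_add_left (ENNReal.ofReal_le_ofReal ?_)
          exact mul_le_of_le_one_left (by positivity)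
            (Real.rpow_le_one_of_one_le_of_nonpos (by simpa using hx) hc.le)
    _ = I + (∫⁻ x, ENNReal.ofReal (‖u x‖ ^ (q / (1 - τ)))) + ∫⁻ x, ENNReal.ofReal (‖u x‖ ^ q) := by
        rw [lintegral_add_right _ (hm _), lintegral_add_right _ (hm _),
          lintegral_indicator measurableSet_ball]
    _ ≤ _ := by
        push_cast
        rw [ENNReal.coe_toNNReal hI]
        exact add_le_add (add_le_add le_rfl (hC₂ u hu hlu)) (hC₁ u hu hlu)

lemma mul_mul_le_of_young {r m a b k : ℝ} (hr1 : 1 < r) (hr2 : r < 2) (hm : m = r / (2 * (r - 1)))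
    (ha : 0 ≤ a) (hb : 0 ≤ b) (hk : 0 ≤ k) :
    a * (k * b) ≤ a ^ r * b ^ r + a ^ r * k ^ m + k ^ m * b ^ r := by
  have hr0 : 0 < r := by linarith
  have hw : 0 < 2 / r - 1 := by rw [sub_pos, one_lt_div hr0]; exact hr2
  have hw' : 0 < 1 - 1 / r := by rw [sub_pos, div_lt_one hr0]; exact hr1
  have hm0 : m * (1 - 1 / r) = 1 / 2 := by
    have : r - 1 ≠ 0 := by linarith
    rw [hm]
    field_simp
  have h := Real.geom_mean_le_arith_mean3_weighted hw.le hw'.le hw'.le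
    (p₁ := a ^ r * b ^ r) (p₂ := a ^ r * k ^ m) (p₃ := k ^ m * b ^ r)
    (by positivity) (by positivity) (by positivity) (by ring)
  have e : a * (k * b) = (a ^ r * b ^ r) ^ (2 / r - 1) * (a ^ r * k ^ m) ^ (1 - 1 / r) *
      (k ^ m * b ^ r) ^ (1 - 1 / r) := by
    have hs : r * (2 / r - 1) + r * (1 - 1 / r) = 1 := by
      field_simp
      ring
    have key {t : ℝ} (ht : 0 ≤ t) : t ^ (r * (2 / r - 1)) * t ^ (r * (1 - 1 / r)) = t := by
      rw [← Real.rpow_add_of_nonneg ht (by positivity) (by positivity), hs, Real.rpow_one]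
    have key' : k ^ (m * (1 - 1 / r)) * k ^ (m * (1 - 1 / r)) = k := by
      rw [hm0, ← Real.rpow_add_of_nonneg hk (by norm_num) (by norm_num)]
      norm_num
    rw [Real.mul_rpow (by positivity) (by positivity), Real.mul_rpow (by positivity) (by positivity),
      Real.mul_rpow (by positivity) (by positivity), ← Real.rpow_mul ha, ← Real.rpow_mul hb,
      ← Real.rpow_mul ha, ← Real.rpow_mul hb, ← Real.rpow_mul hk]
    calc a * (k * b) = (a ^ (r * (2 / r - 1)) * a ^ (r * (1 - 1 / r))) *
          ((k ^ (m * (1 - 1 / r)) * k ^ (m * (1 - 1 / r))) *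
          (b ^ (r * (2 / r - 1)) * b ^ (r * (1 - 1 / r)))) := by rw [key ha, key hb, key']
      _ = _ := by ring
  have hr3 : 2 / r - 1 ≤ 1 := by
    rw [sub_le_iff_le_add, div_le_iff₀ hr0]
    linarith
  have hr4 : 1 - 1 / r ≤ 1 := by linarith [show 0 < 1 / r by positivity]
  rw [e]
  refine h.trans (add_le_add (add_le_add ?_ ?_) ?_) <;>
  exact mul_le_of_le_one_left (by positivity) (by assumption)

/-- A non-homogeneous form of Young's convolution inequality. -/
lemma lintegral_lintegral_mul_le {r m : ℝ} (hr1 : 1 < r) (hr2 : r < 2)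
    (hm : m = r / (2 * (r - 1))) {f k : EV N → ℝ} (hf : Measurable f) (hk : Measurable k)
    (hf0 : ∀ x, 0 ≤ f x) (hk0 : ∀ x, 0 ≤ k x) :
    ∫⁻ x, ∫⁻ y, ENNReal.ofReal (f x * (k (x - y) * f y)) ≤
      (∫⁻ x, ENNReal.ofReal (f x ^ r)) * (∫⁻ x, ENNReal.ofReal (f x ^ r)) +
      (∫⁻ x, ENNReal.ofReal (f x ^ r)) * (∫⁻ x, ENNReal.ofReal (k x ^ m)) +
      (∫⁻ x, ENNReal.ofReal (k x ^ m)) * (∫⁻ x, ENNReal.ofReal (f x ^ r)) := by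
  set F : EV N → ℝ≥0∞ := fun x => ENNReal.ofReal (f x ^ r)
  set H : EV N → ℝ≥0∞ := fun x => ENNReal.ofReal (k x ^ m)
  have hF : Measurable F := (hf.pow_const r).ennreal_ofReal
  have hH : Measurable H := (hk.pow_const m).ennreal_ofReal
  have hle : ∀ x y, ENNReal.ofReal (f x * (k (x - y) * f y)) ≤
      F x * F y + F x * H (x - y) + H (x - y) * F y := fun x y => by
    have := hf0 x
    have := hf0 y
    have := hk0 (x - y)
    simp only [F, H]
    rw [← ENNReal.ofReal_mul (by positivity), ← ENNReal.ofReal_mul (by positivity),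
      ← ENNReal.ofReal_mul (by positivity), ← ENNReal.ofReal_add (by positivity) (by positivity),
      ← ENNReal.ofReal_add (by positivity) (by positivity)]
    exact ENNReal.ofReal_le_ofReal (mul_mul_le_of_young hr1 hr2 hm ‹_› ‹_› ‹_›)
  have h2 : ∀ x, ∫⁻ y, F x * H (x - y) = F x * ∫⁻ z, H z := fun x => by
    rw [lintegral_const_mul _ (by fun_prop), lintegral_sub_left_eq_self]
  have h3 : ∫⁻ x, ∫⁻ y, H (x - y) * F y = (∫⁻ z, H z) * ∫⁻ y, F y := by
    rw [lintegral_lintegral_swap (by fun_prop), ← lintegral_const_mul _ hF]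
    congr 1
    funext y
    rw [lintegral_mul_const _ (by fun_prop), lintegral_sub_right_eq_self]
  calc _ ≤ ∫⁻ x, ∫⁻ y, (F x * F y + F x * H (x - y) + H (x - y) * F y) :=
        lintegral_mono fun x => lintegral_mono fun y => hle x y
    _ = ∫⁻ x, (F x * (∫⁻ y, F y) + F x * (∫⁻ z, H z) + ∫⁻ y, H (x - y) * F y) := by
        congr 1
        funext x
        rw [lintegral_add_left (by fun_prop), lintegral_add_left (by fun_prop),
          lintegral_const_mul _ hF, h2]
    _ = _ := by
        rw [lintegral_add_left (by fun_prop), lintegral_add_left (by fun_prop), h3,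
          lintegral_mul_const _ hF, lintegral_mul_const _ hF]

end Kernel

section Normalized

variable {N : ℕ}

/-- The constant factor of the Riesz potential kernel. -/
def rieszConst (N : ℕ) (α : ℝ) : ℝ :=
  Real.Gamma (((N : ℝ) - α)/2) / (Real.Gamma (α/2) * Real.pi ^ ((N : ℝ)/2) * 2 ^ α)

lemma rieszConst_nonneg {α : ℝ} (hα : 0 < α) (hα' : α < N) : 0 ≤ rieszConst N α := by
  have := Real.Gamma_pos_of_pos (half_pos hα)
  have := Real.Gamma_pos_of_pos (half_pos (sub_pos.2 hα'))
  unfold rieszConst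
  positivity

lemma riesz_eq (α : ℝ) (x : EV N) : riesz N α x = rieszConst N α * ‖x‖ ^ (-(N - α)) := by
  rw [riesz, rieszConst, Real.rpow_neg (norm_nonneg x), div_mul_eq_div_div, div_eq_mul_inv]

/-- Young's inequality on both sides of the Hardy-Littlewood-Sobolev exponent `2N/(N+α)`, applied
to the two halves of the kernel. -/
lemma exists_lintegral_kernel_le (hN : 1 ≤ N) {α b p : ℝ} (hα : 0 < α) (hα' : α < N)
    (hb : max (-((N : ℝ) + α)) (-4*(1 + α/(N : ℝ))) < 2*b) (hb' : 2*b < 0)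
    (hp : 1 + α/(N : ℝ) < p) (hp' : 5 ≤ N → p < 1 + (4 + 2*b + α)/((N : ℝ) - 4)) :
    ∃ C : ℝ≥0, ∀ u : 𝓢(EV N, ℂ), massI ⇑u ≤ 1 → massI (lap ⇑u) ≤ 1 →
      ∫⁻ x, ∫⁻ y, ENNReal.ofReal ((‖x‖ ^ b * ‖u x‖ ^ p) *
        (‖x - y‖ ^ (-(N - α)) * (‖y‖ ^ b * ‖u y‖ ^ p))) ≤ C := by
  have hN0 : (0 : ℝ) < N := by exact_mod_cast hN
  set r₀ : ℝ := 2 * N / (N + α) with hr₀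
  have hb1 := (max_lt_iff.1 hb).1
  have hp0 : 0 < p := lt_trans (by positivity) hp
  have h1 : 1 < r₀ := by rw [hr₀, lt_div_iff₀ (by positivity)]; linarith
  have h2 : r₀ < 2 := by rw [hr₀, div_lt_iff₀ (by positivity)]; linarith
  have hp2 : N + α < N * p := by
    have := mul_lt_mul_of_pos_left hp hN0
    rwa [mul_add, mul_one, mul_div_cancel₀ _ hN0.ne'] at this
  have h3 : 2 < p * r₀ := by
    rw [hr₀, ← mul_div_assoc, lt_div_iff₀ (by positivity)]
    linarith
  have h4 : -(N : ℝ) < b * r₀ := by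
    rw [hr₀, ← mul_div_assoc, lt_div_iff₀ (by positivity)]
    nlinarith
  have h5 : ((N : ℝ) - 4) * (p * r₀) < 2 * (N + b * r₀) := by
    have key : ((N : ℝ) - 4) * p < N + α + 2 * b := by
      rcases le_or_gt 5 N with h | h
      · have hN5 : (5 : ℝ) ≤ N := by exact_mod_cast h
        have := hp' h
        rw [← sub_lt_iff_lt_add', lt_div_iff₀ (by linarith)] at this
        linarith
      · have hN4 : (N : ℝ) ≤ 4 := by exact_mod_cast Nat.lt_succ_iff.1 h
        have : ((N : ℝ) - 4) * p ≤ 0 := mul_nonpos_of_nonpos_of_nonneg (by linarith) hp0.le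
        linarith
    have e : 2 * (N + b * r₀) - (N - 4) * (p * r₀) = (N + α + 2 * b - (N - 4) * p) * r₀ := by
      rw [hr₀]
      field_simp
    have : 0 < (N + α + 2 * b - (N - 4) * p) * r₀ := mul_pos (by linarith) (by linarith)
    linarith
  have hev : ∀ᶠ r in nhds r₀, 1 < r ∧ r < 2 ∧ 2 < p * r ∧ -(N : ℝ) < b * r ∧
      ((N : ℝ) - 4) * (p * r) < 2 * (N + b * r) :=
    (lt_mem_nhds h1).and <| (gt_mem_nhds h2).and <|
      (ContinuousAt.eventually_lt (by fun_prop) (by fun_prop) h3).and <|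
      (ContinuousAt.eventually_lt (by fun_prop) (by fun_prop) h4).and <|
      ContinuousAt.eventually_lt (by fun_prop) (by fun_prop) h5
  obtain ⟨r₁, ⟨hr1, hr2, hr3, hr4, hr5⟩, hr⟩ :=
    ((hev.filter_mono nhdsWithin_le_nhds).and (self_mem_nhdsWithin (s := Set.Ioi r₀))).exists
  obtain ⟨r₂, ⟨hs1, hs2, hs3, hs4, hs5⟩, hs⟩ :=
    ((hev.filter_mono nhdsWithin_le_nhds).and (self_mem_nhdsWithin (s := Set.Iio r₀))).exists
  rw [hr₀, div_lt_iff₀ (by positivity)] at hr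
  rw [hr₀, lt_div_iff₀ (by positivity)] at hs
  have ha : (0 : ℝ) < N - α := sub_pos.2 hα'
  set m₁ := r₁ / (2 * (r₁ - 1)) with hm₁
  set m₂ := r₂ / (2 * (r₂ - 1)) with hm₂
  have hm₁0 : 0 < m₁ := div_pos (by linarith) (by linarith)
  have hm₂0 : 0 < m₂ := div_pos (by linarith) (by linarith)
  have ham₁ : (N - α) * m₁ < N := by
    rw [hm₁, ← mul_div_assoc, div_lt_iff₀ (by linarith)]
    linarith
  have ham₂ : N < (N - α) * m₂ := by
    rw [hm₂, ← mul_div_assoc, lt_div_iff₀ (by linarith)]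
    linarith
  set k₁ : EV N → ℝ := (Metric.ball 0 1).indicator fun z => ‖z‖ ^ (-(N - α))
  set k₂ : EV N → ℝ := (Metric.ball 0 1)ᶜ.indicator fun z => ‖z‖ ^ (-(N - α))
  have hkm : Measurable fun z : EV N => ‖z‖ ^ (-(N - α)) := measurable_norm.pow_const _
  have hk₁m : Measurable k₁ := hkm.indicator measurableSet_ball
  have hk₂m : Measurable k₂ := hkm.indicator measurableSet_ball.compl
  have hk₁0 : ∀ z, 0 ≤ k₁ z := Set.indicator_nonneg fun z _ => by positivity
  have hk₂0 : ∀ z, 0 ≤ k₂ z := Set.indicator_nonneg fun z _ => by positivity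
  have hpow {m : ℝ} (hm : 0 < m) (s : Set (EV N)) (z : EV N) :
      ENNReal.ofReal (s.indicator (fun z => ‖z‖ ^ (-(N - α))) z ^ m) =
        s.indicator (fun z => ENNReal.ofReal (‖z‖ ^ (-((N - α) * m)))) z := by
    by_cases hz : z ∈ s
    · rw [Set.indicator_of_mem hz, Set.indicator_of_mem hz, ← Real.rpow_mul (norm_nonneg z),
        neg_mul]
    · rw [Set.indicator_of_notMem hz, Set.indicator_of_notMem hz, Real.zero_rpow hm.ne',
        ENNReal.ofReal_zero]
  have hK₁ : ∫⁻ z, ENNReal.ofReal (k₁ z ^ m₁) ≠ ⊤ := by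
    simp only [k₁, hpow hm₁0]
    rw [lintegral_indicator measurableSet_ball]
    exact (integrableOn_ball_norm_rpow_neg hN ham₁).lintegral_lt_top.ne
  have hK₂ : ∫⁻ z, ENNReal.ofReal (k₂ z ^ m₂) ≠ ⊤ := by
    simp only [k₂, hpow hm₂0]
    rw [lintegral_indicator measurableSet_ball.compl]
    exact (integrableOn_compl_ball_norm_rpow_neg ham₂).lintegral_lt_top.ne
  set K₁ := ∫⁻ z, ENNReal.ofReal (k₁ z ^ m₁)
  set K₂ := ∫⁻ z, ENNReal.ofReal (k₂ z ^ m₂)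
  have hbr {r : ℝ} (hr : 1 < r) : b * r < 0 := mul_neg_of_neg_of_pos (by linarith) (by linarith)
  obtain ⟨C₁, hC₁⟩ := exists_lintegral_weighted_rpow_le hN (hbr hr1) hr4 hr3 hr5
  obtain ⟨C₂, hC₂⟩ := exists_lintegral_weighted_rpow_le hN (hbr hs1) hs4 hs3 hs5
  refine ⟨(C₁ * C₁ + C₁ * K₁.toNNReal + K₁.toNNReal * C₁) +
    (C₂ * C₂ + C₂ * K₂.toNNReal + K₂.toNNReal * C₂), fun u hu hlu => ?_⟩
  set f : EV N → ℝ := fun x => ‖x‖ ^ b * ‖u x‖ ^ p with hf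
  have hfm : Measurable f :=
    (measurable_norm.pow_const _).mul (u.continuous.norm.measurable.pow_const _)
  have hf0 : ∀ x, 0 ≤ f x := fun x => by positivity
  have hfr (r : ℝ) (x : EV N) : f x ^ r = ‖x‖ ^ (b * r) * ‖u x‖ ^ (p * r) := by
    rw [hf, Real.mul_rpow (by positivity) (by positivity), ← Real.rpow_mul (by positivity),
      ← Real.rpow_mul (by positivity)]
  have hF₁ : ∫⁻ x, ENNReal.ofReal (f x ^ r₁) ≤ C₁ := by simpa only [hfr] using hC₁ u hu hlu
  have hF₂ : ∫⁻ x, ENNReal.ofReal (f x ^ r₂) ≤ C₂ := by simpa only [hfr] using hC₂ u hu hlu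
  have hsplit (x y : EV N) : ENNReal.ofReal (f x * (‖x - y‖ ^ (-(N - α)) * f y)) =
      ENNReal.ofReal (f x * (k₁ (x - y) * f y)) + ENNReal.ofReal (f x * (k₂ (x - y) * f y)) := by
    have := hf0 x
    have := hf0 y
    have := hk₁0 (x - y)
    have := hk₂0 (x - y)
    rw [← ENNReal.ofReal_add (by positivity) (by positivity), ← mul_add, ← add_mul,
      Set.indicator_self_add_compl_apply]
  calc ∫⁻ x, ∫⁻ y, ENNReal.ofReal (f x * (‖x - y‖ ^ (-(N - α)) * f y))
      = (∫⁻ x, ∫⁻ y, ENNReal.ofReal (f x * (k₁ (x - y) * f y))) +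
        ∫⁻ x, ∫⁻ y, ENNReal.ofReal (f x * (k₂ (x - y) * f y)) := by
        simp only [hsplit]
        rw [← lintegral_add_left (Measurable.lintegral_prod_right (by fun_prop))]
        congr 1
        funext x
        rw [lintegral_add_left (by fun_prop)]
    _ ≤ _ := add_le_add (lintegral_lintegral_mul_le hr1 hr2 hm₁ hfm hk₁m hf0 hk₁0)
        (lintegral_lintegral_mul_le hs1 hs2 hm₂ hfm hk₂m hf0 hk₂0)
    _ ≤ _ := by
        push_cast
        rw [ENNReal.coe_toNNReal hK₁, ENNReal.coe_toNNReal hK₂]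
        gcongr

lemma exists_potC_le_of_massI_le (hN : 1 ≤ N) {α b p : ℝ} (hα : 0 < α) (hα' : α < N)
    (hb : max (-((N : ℝ) + α)) (-4*(1 + α/(N : ℝ))) < 2*b) (hb' : 2*b < 0)
    (hp : 1 + α/(N : ℝ) < p) (hp' : 5 ≤ N → p < 1 + (4 + 2*b + α)/((N : ℝ) - 4)) :
    ∃ C : ℝ≥0, ∀ u : 𝓢(EV N, ℂ), massI ⇑u ≤ 1 → massI (lap ⇑u) ≤ 1 → potC α b p ⇑u ≤ C := by
  obtain ⟨C, hC⟩ := exists_lintegral_kernel_le hN hα hα' hb hb' hp hp'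
  refine ⟨(rieszConst N α).toNNReal * C, fun u hu hlu => ?_⟩
  have hc := rieszConst_nonneg hα hα'
  have hpt (x : EV N) : ‖rzConv α b p ⇑u x * ‖x‖ ^ b * ‖u x‖ ^ p‖ₑ ≤
      ENNReal.ofReal (rieszConst N α) * ∫⁻ y, ENNReal.ofReal ((‖x‖ ^ b * ‖u x‖ ^ p) *
        (‖x - y‖ ^ (-(N - α)) * (‖y‖ ^ b * ‖u y‖ ^ p))) := by
    rw [mul_assoc, enorm_mul, mul_comm, rzConv]
    calc _ ≤ ‖‖x‖ ^ b * ‖u x‖ ^ p‖ₑ *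
          ∫⁻ y, ‖riesz N α (x - y) * (‖y‖ ^ b * ‖u y‖ ^ p)‖ₑ := by
          gcongr
          exact enorm_integral_le_lintegral_enorm _
      _ = _ := by
          rw [← lintegral_const_mul' _ _ enorm_ne_top, ← lintegral_const_mul' _ _ (by simp)]
          congr 1
          funext y
          rw [riesz_eq, Real.enorm_of_nonneg (by positivity), Real.enorm_of_nonneg (by positivity),
            ← ENNReal.ofReal_mul (by positivity), ← ENNReal.ofReal_mul (by positivity)]
          congr 1
          ring
  have h : ‖potC α b p ⇑u‖ₑ ≤ ((rieszConst N α).toNNReal * C : ℝ≥0) := by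
    calc ‖potC α b p ⇑u‖ₑ ≤ _ := (enorm_integral_le_lintegral_enorm _).trans (lintegral_mono hpt)
      _ ≤ _ := by
        rw [lintegral_const_mul' _ _ (by simp), ENNReal.coe_mul]
        gcongr
        · exact le_rfl
        · exact hC u hu hlu
  rw [enorm_le_coe] at h
  exact (le_abs_self _).trans (by exact_mod_cast h)

end Normalized

section Scaling

variable {N : ℕ}

lemma pd_smul_comp_smul {F : Type*} [NormedAddCommGroup F] [NormedSpace ℝ F] (j : Fin N)
    (f : EV N → F) (l m : ℝ) (x : EV N) :
    pd j (fun x => m • f (l • x)) x = (m * l) • pd j f (l • x) := by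
  have h : (fun x => m • f (l • x)) = m • fun x => f (l • x) := rfl
  rw [pd, h, fderiv_const_smul_field, Pi.smul_apply, fderiv_comp_smul, smul_smul,
    _root_.smul_apply, pd]

lemma lap_smul_comp_smul {F : Type*} [NormedAddCommGroup F] [NormedSpace ℝ F]
    (f : EV N → F) (l m : ℝ) (x : EV N) :
    lap (fun x => m • f (l • x)) x = (m * l ^ 2) • lap f (l • x) := by
  have h (j : Fin N) : pd j (fun x => m • f (l • x)) = fun x => (m * l) • pd j f (l • x) :=
    funext fun x => pd_smul_comp_smul j f l m x
  simp only [lap, h, pd_smul_comp_smul, Finset.smul_sum]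
  congr! 2
  ring

lemma integral_comp_smul_of_pos (g : EV N → ℝ) {l : ℝ} (hl : 0 < l) :
    ∫ x, g (l • x) = l ^ (-(N : ℝ)) * ∫ x, g x := by
  rw [Measure.integral_comp_smul_of_nonneg _ _ _ (hR := hl.le), finrank_euclideanSpace_fin, smul_eq_mul,
    Real.rpow_neg hl.le, Real.rpow_natCast]

lemma massI_smul_comp_smul (f : EV N → ℂ) {l : ℝ} (hl : 0 < l) (m : ℝ) :
    massI (fun x => m • f (l • x)) = m ^ 2 * (l ^ (-(N : ℝ)) * massI f) := by
  simp only [massI, norm_smul, mul_pow, Real.norm_eq_abs, sq_abs]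
  rw [integral_const_mul, integral_comp_smul_of_pos (fun x => ‖f x‖ ^ 2) hl]

lemma rpow_norm_eq (x : EV N) {l : ℝ} (hl : 0 < l) (s : ℝ) :
    ‖x‖ ^ s = l ^ (-s) * ‖l • x‖ ^ s := by
  rw [norm_smul, Real.norm_of_nonneg hl.le, Real.mul_rpow hl.le (norm_nonneg x), ← mul_assoc,
    ← Real.rpow_add hl, neg_add_cancel, Real.rpow_zero, one_mul]

lemma rzConv_smul_comp_smul (f : EV N → ℂ) {l m : ℝ} (hl : 0 < l) (hm : 0 < m) (α b p : ℝ)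
    (x : EV N) :
    rzConv α b p (fun x => m • f (l • x)) x =
      l ^ (-(α + b)) * m ^ p * rzConv α b p f (l • x) := by
  have h (y : EV N) : riesz N α (x - y) * (‖y‖ ^ b * ‖m • f (l • y)‖ ^ p) =
      (l ^ (N - α) * l ^ (-b) * m ^ p) *
        (riesz N α (l • x - l • y) * (‖l • y‖ ^ b * ‖f (l • y)‖ ^ p)) := by
    rw [riesz_eq, riesz_eq, ← smul_sub, rpow_norm_eq (x - y) hl, rpow_norm_eq y hl b, norm_smul m,
      Real.norm_of_nonneg hm.le, Real.mul_rpow hm.le (norm_nonneg _), neg_neg]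
    ring
  simp only [rzConv, h]
  rw [integral_const_mul, integral_comp_smul_of_pos
    (fun z => riesz N α (l • x - z) * (‖z‖ ^ b * ‖f z‖ ^ p)) hl]
  have e : l ^ (-(α + b)) = l ^ (N - α) * l ^ (-b) * l ^ (-(N : ℝ)) := by
    rw [← Real.rpow_add hl, ← Real.rpow_add hl]
    congr 1
    ring
  rw [e]
  ring

lemma potC_smul_comp_smul (f : EV N → ℂ) {l m : ℝ} (hl : 0 < l) (hm : 0 < m) (α b p : ℝ) :
    potC α b p (fun x => m • f (l • x)) =
      m ^ (2 * p) * l ^ (-(N + α + 2 * b)) * potC α b p f := by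
  have h (x : EV N) : rzConv α b p (fun x => m • f (l • x)) x * ‖x‖ ^ b * ‖m • f (l • x)‖ ^ p =
      (l ^ (-(α + b)) * m ^ p * l ^ (-b) * m ^ p) *
        (rzConv α b p f (l • x) * ‖l • x‖ ^ b * ‖f (l • x)‖ ^ p) := by
    rw [rzConv_smul_comp_smul f hl hm, rpow_norm_eq x hl b, norm_smul m, Real.norm_of_nonneg hm.le,
      Real.mul_rpow hm.le (norm_nonneg _)]
    ring
  simp only [potC, h]
  rw [integral_const_mul, integral_comp_smul_of_pos
    (fun z => rzConv α b p f z * ‖z‖ ^ b * ‖f z‖ ^ p) hl]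
  have e : l ^ (-(N + α + 2 * b)) = l ^ (-(α + b)) * l ^ (-b) * l ^ (-(N : ℝ)) := by
    rw [← Real.rpow_add hl, ← Real.rpow_add hl]
    congr 1
    ring
  have e' : m ^ (2 * p) = m ^ p * m ^ p := by rw [← Real.rpow_add hm, two_mul]
  rw [e, e']
  ring

lemma exists_schwartz_smul_comp_smul (u : 𝓢(EV N, ℂ)) {l : ℝ} (hl : l ≠ 0) (m : ℝ) :
    ∃ v : 𝓢(EV N, ℂ), ⇑v = fun x => m • u (l • x) :=
  ⟨m • compCLMOfContinuousLinearEquiv ℝ (ContinuousLinearEquiv.smulLeft (Units.mk0 l hl)) u, rfl⟩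

lemma eq_zero_of_massI_eq_zero {u : 𝓢(EV N, ℂ)} (h : massI ⇑u = 0) : u = 0 := by
  rw [massI, integral_eq_zero_iff_of_nonneg (fun _ => by positivity) (integrable_norm_sq u),
    Continuous.ae_eq_iff_eq _ (by fun_prop) continuous_zero] at h
  ext x
  simpa using congrFun h x

lemma eq_zero_of_massI_lap_eq_zero (hN : 1 ≤ N) {u : 𝓢(EV N, ℂ)} (h : massI (lap ⇑u) = 0) :
    u = 0 := by
  have : Nonempty (Fin N) := ⟨⟨0, hN⟩⟩
  rw [lap_coe_eq_laplacian] at h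
  have h0 := eq_zero_of_massI_eq_zero h
  refine eq_zero_of_massI_eq_zero ?_
  rw [← massI_fourier]
  refine integral_eq_zero_of_ae ?_
  filter_upwards [compl_mem_ae_iff.2 (measure_singleton (0 : EV N))] with ξ hξ
  have h1 := norm_fourier_laplacian_apply u ξ
  rw [h0, FourierTransform.fourier_zero] at h1
  have h2 : ‖ξ‖ ≠ 0 := norm_ne_zero_iff.2 hξ
  simpa [h2, Real.pi_ne_zero] using h1

end Scaling

/-- **Gagliardo-Nirenberg inequality (Choquard).**
For `N ≥ 1`, `0 < α < N`, `max{-(N+α), -4(1+α/N)} < 2b < 0` and `1 + α/N < p < p^*`,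
there is `C = C(N,p,b,α) > 0` with
`∫(I_α*|·|^b|u|^p)|x|^b|u|^p ≤ C ‖u‖₂^A ‖Δu‖₂^B` for every Schwartz `u`. -/
theorem stmt17 (N : ℕ) (hN : 1 ≤ N) (α b p : ℝ)
    (hα : 0 < α) (hα' : α < N)
    (hb : max (-((N : ℝ) + α)) (-4*(1 + α/(N : ℝ))) < 2*b) (hb' : 2*b < 0)
    (hp : 1 + α/(N : ℝ) < p) (hp' : 5 ≤ N → p < 1 + (4 + 2*b + α)/((N : ℝ) - 4)) :
    ∃ C > 0, ∀ u : SchwartzMap (EV N) ℂ,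
      potC α b p ⇑u ≤ C * (L2 ⇑u) ^ (Ac N α b p) * (L2 (lap ⇑u)) ^ (Bc N α b p) := by
  obtain ⟨C, hC⟩ := exists_potC_le_of_massI_le hN hα hα' hb hb' hp hp'
  have hp0 : 0 < p := lt_trans (by positivity) hp
  refine ⟨C + 1, by positivity, fun u => ?_⟩
  rcases eq_or_ne u 0 with rfl | hu
  · have h0 : potC α b p ⇑(0 : SchwartzMap (EV N) ℂ) = 0 := by
      simp [potC, Real.zero_rpow hp0.ne']
    rw [h0]
    have := massI_nonneg ⇑(0 : SchwartzMap (EV N) ℂ)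
    have := massI_nonneg (lap ⇑(0 : SchwartzMap (EV N) ℂ))
    unfold L2
    positivity
  have hm : 0 < massI ⇑u := (massI_nonneg _).lt_of_ne' fun h => hu (eq_zero_of_massI_eq_zero h)
  have hd : 0 < massI (lap ⇑u) :=
    (massI_nonneg _).lt_of_ne' fun h => hu (eq_zero_of_massI_lap_eq_zero hN h)
  have hA : 0 < L2 ⇑u := Real.rpow_pos_of_pos hm _
  have hD : 0 < L2 (lap ⇑u) := Real.rpow_pos_of_pos hd _
  have hA2 : massI ⇑u = L2 ⇑u ^ 2 := by
    rw [L2, ← Real.sqrt_eq_rpow, Real.sq_sqrt hm.le]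
  have hD2 : massI (lap ⇑u) = L2 (lap ⇑u) ^ 2 := by
    rw [L2, ← Real.sqrt_eq_rpow, Real.sq_sqrt hd.le]
  set A := L2 ⇑u
  set D := L2 (lap ⇑u)
  set l := (A / D) ^ ((1 : ℝ) / 2) with hl
  set m := l ^ ((N : ℝ) / 2) / A with hm'
  have hl0 : 0 < l := by positivity
  have hm0 : 0 < m := by positivity
  have hl2 : l ^ 2 = A / D := by rw [hl, ← Real.sqrt_eq_rpow, Real.sq_sqrt (by positivity)]
  have hlN : (l ^ ((N : ℝ) / 2)) ^ 2 * l ^ (-(N : ℝ)) = 1 := by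
    rw [← Real.rpow_natCast, ← Real.rpow_mul hl0.le, ← Real.rpow_add hl0]
    simp
  obtain ⟨v, hv⟩ := exists_schwartz_smul_comp_smul u hl0.ne' m
  have hvm : massI ⇑v = 1 := by
    rw [hv, massI_smul_comp_smul _ hl0, hA2, hm', div_pow, ← hlN]
    field_simp
  have hvd : massI (lap ⇑v) = 1 := by
    have e : lap ⇑v = fun x => (m * l ^ 2) • lap ⇑u (l • x) := by
      rw [hv]
      exact funext fun x => lap_smul_comp_smul _ l m x
    rw [e, massI_smul_comp_smul _ hl0, hD2, hm', hl2, ← hlN]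
    field_simp
  have hvC := hC v hvm.le hvd.le
  rw [hv, potC_smul_comp_smul _ hl0 hm0] at hvC
  have e : A ^ Ac N α b p * D ^ Bc N α b p * (m ^ (2 * p) * l ^ (-(N + α + 2 * b))) = 1 := by
    rw [hm', Real.div_rpow (by positivity) hA.le, ← Real.rpow_mul hl0.le, div_mul_eq_mul_div,
      ← Real.rpow_add hl0, hl, ← Real.rpow_mul (by positivity), Real.div_rpow hA.le hD.le, Ac,
      Real.rpow_sub hA,
      show (1 : ℝ) / 2 * ((N : ℝ) / 2 * (2 * p) + -(N + α + 2 * b)) = Bc N α b p by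
        rw [Bc]; ring]
    field_simp
  calc potC α b p ⇑u = A ^ Ac N α b p * D ^ Bc N α b p *
        (m ^ (2 * p) * l ^ (-(N + α + 2 * b)) * potC α b p ⇑u) := by
        rw [← mul_assoc, e, one_mul]
    _ ≤ A ^ Ac N α b p * D ^ Bc N α b p * (C + 1) := by
        gcongr
        linarith
    _ = _ := by ring
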